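/- Let d = 1 or d = 2, and let q : ℝ^d → ℝ be continuous. Suppose there exists ψ ∈ C²(ℝ^d) with ψ > 0, ψ bounded, and −Δψ + qψ = 0 on ℝ^d. Let V : ℝ^d → ℝ be continuous and assume that for every u ∈ C_c^∞(ℝ^d) both ∫_{ℝ^d} (|∇u|² + (q+V)u²) dx ≥ 0 and ∫_{ℝ^d} (|∇u|² + (q−V)u²) dx ≥ 0. Then V ≡ 0. -/

import Mathlib

open MeasureTheory

noncomputable section

abbrev Ed (d : ℕ) := EuclideanSpace ℝ (Fin d)

/-- A smooth compactly supported test function on ℝ^d. -/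
def IsTest {d : ℕ} (u : Ed d → ℝ) : Prop :=
  ContDiff ℝ (⊤ : ℕ∞) u ∧ HasCompactSupport u

/-- The Laplacian `Δu(x) = ∑ᵢ ∂ᵢ²u(x)`. -/
def lap {d : ℕ} (u : Ed d → ℝ) (x : Ed d) : ℝ :=
  ∑ i, fderiv ℝ (fun y => fderiv ℝ u y (EuclideanSpace.single i 1)) x
    (EuclideanSpace.single i 1)

lemma grad_sq {d : ℕ} (u : Ed d → ℝ) (x : Ed d) :
    ‖gradient u x‖ ^ 2 = ∑ i, (fderiv ℝ u x (EuclideanSpace.single i 1)) ^ 2 := by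
  rw [EuclideanSpace.norm_sq_eq]
  refine Finset.sum_congr rfl fun i _ => ?_
  have : gradient u x i = fderiv ℝ u x (EuclideanSpace.single i 1) := by
    have h := InnerProductSpace.toDual_symm_apply (𝕜 := ℝ) (x := EuclideanSpace.single i (1:ℝ))
      (y := fderiv ℝ u x)
    rw [EuclideanSpace.inner_single_right] at h
    simpa [gradient] using h
  rw [this, Real.norm_eq_abs, sq_abs]

lemma norm_grad {d : ℕ} (u : Ed d → ℝ) (x : Ed d) : ‖gradient u x‖ = ‖fderiv ℝ u x‖ := by
  simp [gradient]

lemma mollify {d : ℕ} (u : Ed d → ℝ) (hu : ContDiff ℝ 1 u) (hc : HasCompactSupport u) :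
    ∃ R : ℝ, (∀ x, R < ‖x‖ → u x = 0) ∧ ∀ ε > 0, ∃ w : Ed d → ℝ, IsTest w ∧
      (∀ x, R < ‖x‖ → w x = 0) ∧ (∀ x, |w x - u x| ≤ ε) ∧
      (∀ x, ‖fderiv ℝ w x - fderiv ℝ u x‖ ≤ ε) := by
  obtain ⟨R, hR⟩ := hc.isCompact.isBounded.subset_closedBall 0
  have hR0 : ∀ x, R < ‖x‖ → u x = 0 := by
    intro x hx
    by_contra h
    have := hR (subset_tsupport _ h)
    simp at this
    linarith
  refine ⟨R + 1, fun x hx => hR0 x (by linarith), fun ε hε => ?_⟩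
  have huc := hc.uniformContinuous_of_continuous hu.continuous
  have hfc := (hc.fderiv ℝ).uniformContinuous_of_continuous (hu.continuous_fderiv one_ne_zero)
  rw [Metric.uniformContinuous_iff] at huc hfc
  obtain ⟨δ₁, h1, h1'⟩ := huc ε hε
  obtain ⟨δ₂, h2, h2'⟩ := hfc ε hε
  let r : ℝ := min 1 (min δ₁ δ₂)
  have hr : 0 < r := by positivity
  have hr1 : r ≤ 1 := min_le_left _ _
  have hrd1 : r ≤ δ₁ := (min_le_right _ _).trans (min_le_left _ _)
  have hrd2 : r ≤ δ₂ := (min_le_right _ _).trans (min_le_right _ _)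
  let φ : ContDiffBump (0 : Ed d) := ⟨r / 2, r, by positivity, by linarith⟩
  have hφr : φ.rOut = r := rfl
  have hloc : LocallyIntegrable (φ.normed volume) (volume : Measure (Ed d)) :=
    φ.continuous_normed.locallyIntegrable
  refine ⟨convolution (φ.normed volume) u (ContinuousLinearMap.lsmul ℝ ℝ) volume, ⟨?_, ?_⟩, ?_, ?_, ?_⟩
  · exact φ.hasCompactSupport_normed.contDiff_convolution_left _ φ.contDiff_normed
      hu.continuous.locallyIntegrable
  · exact φ.hasCompactSupport_normed.convolution _ hc
  · intro x hx
    by_contra h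
    obtain ⟨a, ha, b, hb, rfl⟩ := support_convolution_subset _ (Function.mem_support.2 h)
    rw [φ.support_normed_eq] at ha
    simp [hφr] at ha
    have hb' : ‖b‖ ≤ R := by
      by_contra hh
      exact hb (hR0 b (not_le.1 hh))
    have := norm_add_le a b
    linarith
  · intro x
    rw [← Real.dist_eq]
    refine φ.dist_normed_convolution_le hu.continuous.aestronglyMeasurable ?_
    intro y hy
    exact (h1' (lt_of_lt_of_le hy hrd1)).le
  · intro x
    have hd := hc.hasFDerivAt_convolution_right (ContinuousLinearMap.lsmul ℝ ℝ) hloc hu x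
    rw [hd.fderiv, ← dist_eq_norm]
    have : (ContinuousLinearMap.precompR (Ed d) (ContinuousLinearMap.lsmul ℝ ℝ (E := ℝ)))
        = ContinuousLinearMap.lsmul ℝ ℝ := by
      ext; simp
    rw [this]
    refine φ.dist_normed_convolution_le
      (hu.continuous_fderiv one_ne_zero).aestronglyMeasurable ?_
    intro y hy
    exact (h2' (lt_of_lt_of_le hy hrd2)).le

lemma extend {d : ℕ} (p : Ed d → ℝ) (hp : Continuous p)
    (h : ∀ u : Ed d → ℝ, IsTest u → 0 ≤ ∫ x, (‖gradient u x‖ ^ 2 + p x * u x ^ 2))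
    (u : Ed d → ℝ) (hu : ContDiff ℝ 1 u) (hc : HasCompactSupport u) :
    0 ≤ ∫ x, (‖gradient u x‖ ^ 2 + p x * u x ^ 2) := by
  obtain ⟨R, hR, hw⟩ := mollify u hu hc
  choose! w hwt hwR hwu hwf using hw
  let e : ℕ → ℝ := fun n => 1 / ((n : ℝ) + 1)
  have he : ∀ n, 0 < e n := fun n => by positivity
  have he1 : ∀ n, e n ≤ 1 := fun n => by
    simp only [e]; rw [div_le_one (by positivity)]; linarith [(Nat.cast_nonneg n : (0:ℝ) ≤ n)]
  have hel : Filter.Tendsto e Filter.atTop (nhds 0) := tendsto_one_div_add_atTop_nhds_zero_nat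
  obtain ⟨A, hA⟩ := hu.continuous.bounded_above_of_compact_support hc
  obtain ⟨B, hB⟩ := (hu.continuous_fderiv one_ne_zero).bounded_above_of_compact_support
    (hc.fderiv ℝ)
  obtain ⟨P, hP⟩ := (isCompact_closedBall (0 : Ed d) R).exists_bound_of_continuousOn
    hp.continuousOn
  have hlim : Filter.Tendsto (fun n => ∫ x, (‖gradient (w (e n)) x‖ ^ 2 + p x * w (e n) x ^ 2))
      Filter.atTop (nhds (∫ x, (‖gradient u x‖ ^ 2 + p x * u x ^ 2))) := by
    refine tendsto_integral_of_dominated_convergence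
      ((Metric.closedBall (0 : Ed d) R).indicator fun _ => (B + 1) ^ 2 + P * (A + 1) ^ 2)
      ?_ ?_ ?_ ?_
    · intro n
      have h1 := (hwt _ (he n)).1
      have h2 : Continuous fun x => ‖gradient (w (e n)) x‖ := by
        simp_rw [norm_grad]
        exact (h1.continuous_fderiv (by simp)).norm
      have h3 := h1.continuous
      exact Continuous.aestronglyMeasurable (by fun_prop)
    · rw [integrable_indicator_iff measurableSet_closedBall]
      exact integrableOn_const (isCompact_closedBall _ _).measure_lt_top.ne
    · intro n
      refine Filter.Eventually.of_forall fun x => ?_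
      by_cases hx : x ∈ Metric.closedBall (0 : Ed d) R
      · rw [Set.indicator_of_mem hx]
        have h1 : ‖gradient (w (e n)) x‖ ≤ B + 1 := by
          rw [norm_grad]
          have a := hwf _ (he n) x
          have b := hB x
          have c := he1 n
          have := norm_sub_norm_le (fderiv ℝ (w (e n)) x) (fderiv ℝ u x)
          linarith
        have h2 : |w (e n) x| ≤ A + 1 := by
          have a := hwu _ (he n) x
          have b := hA x
          rw [Real.norm_eq_abs] at b
          have c := he1 n
          have := abs_sub_abs_le_abs_sub (w (e n) x) (u x)
          linarith
        refine (norm_add_le _ _).trans ?_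
        rw [norm_mul, norm_pow, norm_pow, norm_norm, Real.norm_eq_abs (w _ _)]
        have := hP x hx
        have := (norm_nonneg _).trans this
        gcongr
      · rw [Set.indicator_of_notMem hx]
        have hx' : R < ‖x‖ := by simpa using hx
        have h0 := hwR _ (he n) x hx'
        have h1 : w (e n) =ᶠ[nhds x] fun _ => 0 := by
          have : {y : Ed d | R < ‖y‖} ∈ nhds x :=
            (isOpen_lt continuous_const continuous_norm).mem_nhds hx'
          filter_upwards [this] with y hy
          exact hwR _ (he n) y hy
        rw [norm_grad, h1.fderiv_eq, h0]
        simp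
    · refine Filter.Eventually.of_forall fun x => ?_
      have t1 : Filter.Tendsto (fun n => w (e n) x) Filter.atTop (nhds (u x)) := by
        rw [tendsto_iff_dist_tendsto_zero]
        exact squeeze_zero (fun _ => dist_nonneg)
          (fun n => by rw [Real.dist_eq]; exact hwu _ (he n) x) hel
      have t2 : Filter.Tendsto (fun n => fderiv ℝ (w (e n)) x) Filter.atTop
          (nhds (fderiv ℝ u x)) := by
        rw [tendsto_iff_dist_tendsto_zero]
        exact squeeze_zero (fun _ => dist_nonneg)
          (fun n => by rw [dist_eq_norm]; exact hwf _ (he n) x) hel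
      simp_rw [norm_grad]
      exact (t2.norm.pow 2).add ((t1.pow 2).const_mul _)
  exact ge_of_tendsto' hlim fun n => h _ (hwt _ (he n))

lemma cint {d : ℕ} {f : Ed d → ℝ} (K : Set (Ed d)) (hK : IsCompact K) (hf : Continuous f)
    (h : ∀ x, x ∉ K → f x = 0) : Integrable f :=
  hf.integrable_of_hasCompactSupport (HasCompactSupport.intro hK h)

lemma ground {d : ℕ} (q p ψ g : Ed d → ℝ) (hq : Continuous q) (hp : Continuous p)
    (hψ : ContDiff ℝ 2 ψ) (hsol : ∀ x, -lap ψ x + q x * ψ x = 0)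
    (hg : IsTest g) :
    ∫ x, (‖gradient (fun y => g y * ψ y) x‖ ^ 2 + (q x + p x) * (g x * ψ x) ^ 2)
      = (∫ x, ψ x ^ 2 * ‖gradient g x‖ ^ 2) + ∫ x, p x * ψ x ^ 2 * g x ^ 2 := by
  obtain ⟨hgs, hgc⟩ := hg
  have hg1 : ContDiff ℝ 2 g := (contDiff_infty.1 hgs) 2
  have gd : Differentiable ℝ g := hg1.differentiable (by simp)
  have pd : Differentiable ℝ ψ := hψ.differentiable (by simp)
  have hgcont := hg1.continuous
  have hpcont := hψ.continuous
  have hψf : ContDiff ℝ 1 (fderiv ℝ ψ) := hψ.fderiv_right (by norm_num)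
  let w : Ed d → ℝ := fun x => g x ^ 2 * ψ x
  have hw : ContDiff ℝ 2 w := (hg1.pow 2).mul hψ
  have hwf : Continuous (fderiv ℝ w) := hw.continuous_fderiv (by simp)
  have g0 : ∀ x, x ∉ tsupport g → g x = 0 := fun x hx => image_eq_zero_of_notMem_tsupport hx
  have gf0 : ∀ x, x ∉ tsupport g → fderiv ℝ g x = 0 := fun x hx =>
    fderiv_of_notMem_tsupport (𝕜 := ℝ) hx
  have wf : ∀ x v, fderiv ℝ w x v = g x ^ 2 * fderiv ℝ ψ x v + 2 * g x * ψ x * fderiv ℝ g x v := by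
    intro x v
    have := (((gd x).hasFDerivAt.pow 2).mul (pd x).hasFDerivAt).fderiv
    change fderiv ℝ w x = _ at this
    rw [this]
    simp
    ring
  have gpf : ∀ x v, fderiv ℝ (fun y => g y * ψ y) x v
      = g x * fderiv ℝ ψ x v + ψ x * fderiv ℝ g x v := by
    intro x v
    have := ((gd x).hasFDerivAt.mul (pd x).hasFDerivAt).fderiv
    change fderiv ℝ (fun y => g y * ψ y) x = _ at this
    rw [this]
    simp
  have key : ∀ i : Fin d, ∫ x, fderiv ℝ ψ x (EuclideanSpace.single i 1) *
      fderiv ℝ w x (EuclideanSpace.single i 1) =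
      - ∫ x, fderiv ℝ (fun y => fderiv ℝ ψ y (EuclideanSpace.single i 1)) x
          (EuclideanSpace.single i 1) * w x := by
    intro i
    have hD : ContDiff ℝ 1 (fun y => fderiv ℝ ψ y (EuclideanSpace.single i 1)) :=
      hψf.clm_apply contDiff_const
    have hDf := hD.continuous_fderiv one_ne_zero
    have hDc := hD.continuous
    have hwc := hw.continuous
    refine integral_mul_fderiv_eq_neg_fderiv_mul_of_integrable ?_ ?_ ?_ ?_ ?_
    · exact cint _ hgc.isCompact (by fun_prop) fun x hx => by simp [w, g0 x hx]
    · exact cint _ hgc.isCompact (by fun_prop) fun x hx => by simp [wf, g0 x hx]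
    · exact cint _ hgc.isCompact (by fun_prop) fun x hx => by simp [w, g0 x hx]
    · exact fun x _ => hD.differentiable (by simp) x
    · exact fun x _ => hw.differentiable (by simp) x
  have hgg : Continuous fun x => ‖gradient g x‖ := by
    simp_rw [norm_grad]
    exact (hg1.continuous_fderiv (by simp)).norm
  have hψfc := hψf.continuous
  have I1 : Integrable fun x => ψ x ^ 2 * ‖gradient g x‖ ^ 2 :=
    cint _ hgc.isCompact (by fun_prop) fun x hx => by simp [norm_grad, gf0 x hx]
  have I2 : Integrable fun x => p x * ψ x ^ 2 * g x ^ 2 :=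
    cint _ hgc.isCompact (by fun_prop) fun x hx => by simp [g0 x hx]
  have I3 : Integrable fun x => q x * ψ x * w x :=
    cint _ hgc.isCompact (by have := hw.continuous; fun_prop) fun x hx => by simp [w, g0 x hx]
  have J : ∀ i : Fin d, Integrable fun x => fderiv ℝ ψ x (EuclideanSpace.single i 1) *
      fderiv ℝ w x (EuclideanSpace.single i 1) := fun i =>
    cint _ hgc.isCompact (by fun_prop) fun x hx => by simp [wf, g0 x hx]
  have J' : ∀ i : Fin d, Integrable fun x =>
      fderiv ℝ (fun y => fderiv ℝ ψ y (EuclideanSpace.single i 1)) x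
          (EuclideanSpace.single i 1) * w x := fun i => by
    have hD : ContDiff ℝ 1 (fun y => fderiv ℝ ψ y (EuclideanSpace.single i 1)) :=
      hψf.clm_apply contDiff_const
    have hDf := hD.continuous_fderiv one_ne_zero
    have hwc := hw.continuous
    exact cint _ hgc.isCompact (by fun_prop) fun x hx => by simp [w, g0 x hx]
  have tot : ∫ x, ∑ i, fderiv ℝ ψ x (EuclideanSpace.single i 1) *
      fderiv ℝ w x (EuclideanSpace.single i 1) = - ∫ x, q x * ψ x * w x := by
    rw [integral_finsetSum _ fun i _ => J i, Finset.sum_congr rfl fun i _ => key i,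
      Finset.sum_neg_distrib, ← integral_finsetSum _ fun i _ => J' i]
    congr 1
    refine integral_congr_ae (Filter.Eventually.of_forall fun x => ?_)
    simp only
    rw [← Finset.sum_mul]
    have := hsol x
    unfold lap at this
    congr 1
    linarith
  have pt : ∀ x, ‖gradient (fun y => g y * ψ y) x‖ ^ 2 + (q x + p x) * (g x * ψ x) ^ 2
      = (ψ x ^ 2 * ‖gradient g x‖ ^ 2 + p x * ψ x ^ 2 * g x ^ 2) +
        ((∑ i, fderiv ℝ ψ x (EuclideanSpace.single i 1) *
      fderiv ℝ w x (EuclideanSpace.single i 1)) + q x * ψ x * w x) := by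
    intro x
    have : ‖gradient (fun y => g y * ψ y) x‖ ^ 2 = ψ x ^ 2 * ‖gradient g x‖ ^ 2 +
      ∑ i, fderiv ℝ ψ x (EuclideanSpace.single i 1) *
      fderiv ℝ w x (EuclideanSpace.single i 1) := by
      rw [grad_sq, grad_sq, Finset.mul_sum, ← Finset.sum_add_distrib]
      refine Finset.sum_congr rfl fun i _ => ?_
      rw [gpf, wf]
      ring
    rw [this]
    simp only [w]
    ring
  simp_rw [pt]
  have I4 : Integrable fun x => ∑ i, fderiv ℝ ψ x (EuclideanSpace.single i 1) *
      fderiv ℝ w x (EuclideanSpace.single i 1) := integrable_finsetSum _ fun i _ => J i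
  have I5 := integral_add I1 I2
  have I6 := integral_add I4 I3
  have I7 := integral_add (I1.add I2) (I4.add I3)
  simp only [Pi.add_apply] at I5 I6 I7
  rw [I7, I5, I6, tot]
  ring

lemma cutoff {d : ℕ} (hd : d ≤ 2) (ψ : Ed d → ℝ) (hψ : Continuous ψ) (hpos : ∀ x, 0 < ψ x)
    (M : ℝ) (hM : ∀ x, ψ x ≤ M) (R ε : ℝ) (hε : 0 < ε) :
    ∃ φ : Ed d → ℝ, IsTest φ ∧ (∀ x, ‖x‖ ≤ R → φ x = 1) ∧
      ∫ x, ψ x ^ 2 * ‖gradient φ x‖ ^ 2 ≤ ε := by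
  let η : ContDiffBump (0 : Ed d) := ⟨1, 2, one_pos, one_lt_two⟩
  have hη1 : η.rIn = 1 := rfl
  have hη2 : η.rOut = 2 := rfl
  have hηs : ContDiff ℝ (⊤ : ℕ∞) (η : Ed d → ℝ) := η.contDiff
  have hηd : Differentiable ℝ (η : Ed d → ℝ) := hηs.differentiable (by simp)
  have hηc : Continuous (fderiv ℝ (η : Ed d → ℝ)) := hηs.continuous_fderiv (by simp)
  obtain ⟨K, hK⟩ := pow_unbounded_of_one_lt R (by norm_num : (1:ℝ) < 4)
  let c : ℕ → ℝ := fun k => ((4:ℝ) ^ (K + k))⁻¹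
  have c0 : ∀ k, 0 < c k := fun k => by positivity
  have c1 : ∀ k, c k ≤ 1 := fun k => inv_le_one_of_one_le₀ (one_le_pow₀ (by norm_num))
  have cc : ∀ j k, j < k → 4 * c k ≤ c j := by
    intro j k hjk
    obtain ⟨m, rfl⟩ := Nat.exists_eq_add_of_lt hjk
    simp only [c]
    have : (4:ℝ) ^ (K + (j + m + 1)) = 4 ^ (K + j) * 4 ^ m * 4 := by ring
    rw [this, mul_inv, mul_inv]
    have h4 : ((4:ℝ) ^ m)⁻¹ ≤ 1 := inv_le_one_of_one_le₀ (one_le_pow₀ (by norm_num))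
    have h5 : (0:ℝ) < ((4:ℝ) ^ (K + j))⁻¹ := by positivity
    nlinarith
  let ηk : ℕ → Ed d → ℝ := fun k x => η (c k • x)
  have ηks : ∀ k, ContDiff ℝ (⊤ : ℕ∞) (ηk k) := fun k => hηs.comp (contDiff_const_smul _)
  have ηkc : ∀ k, HasCompactSupport (ηk k) := fun k =>
    η.hasCompactSupport.comp_smul (c0 k).ne'
  have ηkf : ∀ k x, fderiv ℝ (ηk k) x = c k • fderiv ℝ η (c k • x) := fun k x => by
    simp only [ηk]
    exact fderiv_comp_smul ..
  have z1 : ∀ y : Ed d, fderiv ℝ η y ≠ 0 → 1 ≤ ‖y‖ ∧ ‖y‖ ≤ 2 := by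
    intro y hy
    constructor
    · by_contra h
      push Not at h
      apply hy
      have : (η : Ed d → ℝ) =ᶠ[nhds y] fun _ => 1 := by
        filter_upwards [Metric.isOpen_ball.mem_nhds (show y ∈ Metric.ball (0 : Ed d) 1 by simpa)]
          with z hz
        exact η.one_of_mem_closedBall (Metric.ball_subset_closedBall hz)
      rw [this.fderiv_eq]
      simp
    · by_contra h
      push Not at h
      apply hy
      apply fderiv_of_notMem_tsupport
      rw [η.tsupport_eq]
      simpa [hη2] using h
  have disj : ∀ j k x, j ≠ k → fderiv ℝ (ηk j) x ≠ 0 → fderiv ℝ (ηk k) x = 0 := by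
    have : ∀ j k x, j < k → fderiv ℝ (ηk j) x ≠ 0 → fderiv ℝ (ηk k) x ≠ 0 → False := by
      intro j k x hjk hj hk
      rw [ηkf] at hj hk
      have a := (z1 _ (right_ne_zero_of_smul hj)).2
      have b := (z1 _ (right_ne_zero_of_smul hk)).1
      rw [norm_smul, Real.norm_of_nonneg (c0 _).le] at a b
      have := cc j k hjk
      have := norm_nonneg x
      nlinarith
    intro j k x hjk hj
    by_contra hk
    rcases lt_or_gt_of_ne hjk with h | h
    · exact this j k x h hj hk
    · exact this k j x h hk hj
  let C : ℝ := ∫ x, ‖fderiv ℝ (η : Ed d → ℝ) x‖ ^ 2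
  have hC : 0 ≤ C := integral_nonneg fun x => by positivity
  have Ik : ∀ k, Integrable fun x => ‖fderiv ℝ (ηk k) x‖ ^ 2 := fun k => by
    refine cint _ (ηkc k).isCompact
      ((((ηks k).continuous_fderiv (by simp)).norm).pow 2) fun x hx => ?_
    rw [fderiv_of_notMem_tsupport (𝕜 := ℝ) hx]; simp
  have Ck : ∀ k, ∫ x, ‖fderiv ℝ (ηk k) x‖ ^ 2 ≤ C := by
    intro k
    simp_rw [ηkf, norm_smul, mul_pow]
    rw [integral_const_mul,
      Measure.integral_comp_smul volume (fun y => ‖fderiv ℝ (η : Ed d → ℝ) y‖ ^ 2) (c k)]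
    have := c0 k
    rw [finrank_euclideanSpace_fin, Real.norm_of_nonneg this.le, abs_of_pos (by positivity),
      smul_eq_mul, ← mul_assoc]
    refine mul_le_of_le_one_left hC ?_
    rw [← div_eq_mul_inv, div_le_one (by positivity)]
    exact pow_le_pow_of_le_one this.le (c1 k) hd
  obtain ⟨n, hn⟩ := exists_nat_gt (M ^ 2 * C / ε)
  have hn0 : (0:ℝ) < n := lt_of_le_of_lt (by positivity) hn
  let φ : Ed d → ℝ := fun x => (n:ℝ)⁻¹ * ∑ k ∈ Finset.range n, ηk k x
  have hφs : ContDiff ℝ (⊤ : ℕ∞) φ :=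
    contDiff_const.mul (ContDiff.sum fun k _ => ηks k)
  have hφf : ∀ x, fderiv ℝ φ x = (n:ℝ)⁻¹ • ∑ k ∈ Finset.range n, fderiv ℝ (ηk k) x := by
    intro x
    have h : HasFDerivAt (fun x => ∑ k ∈ Finset.range n, ηk k x)
        (∑ k ∈ Finset.range n, fderiv ℝ (ηk k) x) x :=
      HasFDerivAt.fun_sum fun k _ => ((ηks k).differentiable (by simp) x).hasFDerivAt
    exact (h.const_mul _).fderiv
  have hφc : HasCompactSupport φ := by
    refine HasCompactSupport.intro
      ((Finset.range n).isCompact_biUnion fun k _ => (ηkc k).isCompact) fun x hx => ?_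
    simp only [φ]
    rw [Finset.sum_eq_zero, mul_zero]
    intro k hk
    refine image_eq_zero_of_notMem_tsupport fun h => hx ?_
    exact Set.mem_biUnion (by exact hk) h
  refine ⟨φ, ⟨hφs, hφc⟩, ?_, ?_⟩
  · intro x hx
    have : ∀ k ∈ Finset.range n, ηk k x = 1 := by
      intro k _
      refine η.one_of_mem_closedBall ?_
      rw [mem_closedBall_zero_iff, norm_smul, Real.norm_of_nonneg (c0 k).le, hη1]
      simp only [c]
      rw [inv_mul_le_iff₀ (by positivity), mul_one]
      exact (hx.trans hK.le).trans (pow_le_pow_right₀ (by norm_num) (by omega))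
    simp only [φ]
    rw [Finset.sum_congr rfl this]
    simp
    field_simp
  · have pt : ∀ x, ψ x ^ 2 * ‖gradient φ x‖ ^ 2 ≤
        M ^ 2 * ((n:ℝ)⁻¹ ^ 2 * ∑ k ∈ Finset.range n, ‖fderiv ℝ (ηk k) x‖ ^ 2) := by
      intro x
      have e : ‖∑ k ∈ Finset.range n, fderiv ℝ (ηk k) x‖ ^ 2
          = ∑ k ∈ Finset.range n, ‖fderiv ℝ (ηk k) x‖ ^ 2 := by
        by_cases h : ∃ j ∈ Finset.range n, fderiv ℝ (ηk j) x ≠ 0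
        · obtain ⟨j, hj, hj'⟩ := h
          have hz : ∀ k ∈ Finset.range n, k ≠ j → fderiv ℝ (ηk k) x = 0 := fun k _ hk =>
            disj j k x hk.symm hj'
          rw [Finset.sum_eq_single_of_mem j hj hz, Finset.sum_eq_single_of_mem j hj]
          intro k hk hkj
          rw [hz k hk hkj]; simp
        · push Not at h
          rw [Finset.sum_eq_zero h, Finset.sum_eq_zero]
          · simp
          · intro k hk
            rw [h k hk]; simp
      rw [norm_grad, hφf, norm_smul, mul_pow, e, Real.norm_of_nonneg (by positivity)]
      exact mul_le_mul_of_nonneg_right (pow_le_pow_left₀ (hpos x).le (hM x) 2)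
        (mul_nonneg (sq_nonneg _) (Finset.sum_nonneg fun k _ => sq_nonneg _))
    have Is : Integrable fun x => ∑ k ∈ Finset.range n, ‖fderiv ℝ (ηk k) x‖ ^ 2 :=
      integrable_finsetSum _ fun k _ => Ik k
    calc ∫ x, ψ x ^ 2 * ‖gradient φ x‖ ^ 2
        ≤ ∫ x, M ^ 2 * ((n:ℝ)⁻¹ ^ 2 * ∑ k ∈ Finset.range n, ‖fderiv ℝ (ηk k) x‖ ^ 2) :=
          integral_mono_of_nonneg (Filter.Eventually.of_forall fun x => by positivity)
            ((Is.const_mul _).const_mul _) (Filter.Eventually.of_forall pt)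
      _ = M ^ 2 * ((n:ℝ)⁻¹ ^ 2 * ∑ k ∈ Finset.range n, ∫ x, ‖fderiv ℝ (ηk k) x‖ ^ 2) := by
          rw [integral_const_mul, integral_const_mul, integral_finsetSum _ fun k _ => Ik k]
      _ ≤ M ^ 2 * ((n:ℝ)⁻¹ ^ 2 * ∑ k ∈ Finset.range n, C) := by
          gcongr with k _
          exact Ck k
      _ = M ^ 2 * C / n := by
          simp
          field_simp
      _ ≤ ε := by
          rw [div_le_iff₀ hn0]
          rw [div_lt_iff₀ hε] at hn
          linarith

lemma grad_lin {d : ℕ} (φ f : Ed d → ℝ) (hφ : Differentiable ℝ φ) (hf : Differentiable ℝ f)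
    (t : ℝ) (x : Ed d) :
    gradient (fun y => φ y + t * f y) x = gradient φ x + t • gradient f x := by
  have := ((hφ x).hasFDerivAt.add ((hf x).hasFDerivAt.const_mul t)).fderiv
  change fderiv ℝ (fun y => φ y + t * f y) x = _ at this
  simp [gradient, this]

/-- The Damanik–Killip–Simon theorem (Theorem 11.2): for `d = 1, 2`, if
`-Δ + q` admits a bounded positive solution `ψ` and both `-Δ + q ± V ≥ 0`
(as quadratic forms on `C_c^∞(ℝ^d)`), then `V ≡ 0`, i.e. `-Δ + q` is critical. -/
theorem stmt7 (d : ℕ) (hd : d = 1 ∨ d = 2) (q V ψ : Ed d → ℝ)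
    (hq : Continuous q) (hV : Continuous V)
    (hψ : ContDiff ℝ 2 ψ) (hψpos : ∀ x, 0 < ψ x) (hψbdd : ∃ M : ℝ, ∀ x, ψ x ≤ M)
    (hsol : ∀ x, -lap ψ x + q x * ψ x = 0)
    (hplus : ∀ u : Ed d → ℝ, IsTest u →
      0 ≤ ∫ x, (‖gradient u x‖ ^ 2 + (q x + V x) * u x ^ 2))
    (hminus : ∀ u : Ed d → ℝ, IsTest u →
      0 ≤ ∫ x, (‖gradient u x‖ ^ 2 + (q x - V x) * u x ^ 2)) :
    ∀ x, V x = 0 := by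
  obtain ⟨M, hM⟩ := hψbdd
  have hd2 : d ≤ 2 := by omega
  have hψc := hψ.continuous
  let E : (Ed d → ℝ) → ℝ := fun g => ∫ x, ψ x ^ 2 * ‖gradient g x‖ ^ 2
  let W : (Ed d → ℝ) → ℝ := fun g => ∫ x, V x * ψ x ^ 2 * g x ^ 2
  have prodT : ∀ g, IsTest g → ContDiff ℝ 1 (fun y => g y * ψ y) ∧
      HasCompactSupport (fun y => g y * ψ y) := fun g hg =>
    ⟨((contDiff_infty.1 hg.1) 1).mul (hψ.of_le (by norm_num)), hg.2.mul_right⟩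
  have b1 : ∀ g, IsTest g → 0 ≤ E g + W g := by
    intro g hg
    have h1 := extend (fun x => q x + V x) (hq.add hV) hplus _ (prodT g hg).1 (prodT g hg).2
    have h2 := ground q V ψ g hq hV hψ hsol hg
    rw [h2] at h1
    exact h1
  have b2 : ∀ g, IsTest g → W g ≤ E g := by
    intro g hg
    have h1 := extend (fun x => q x + -V x) (hq.add hV.neg)
      (by simpa only [← sub_eq_add_neg] using hminus) _ (prodT g hg).1 (prodT g hg).2
    have h2 := ground q (fun x => -V x) ψ g hq hV.neg hψ hsol hg
    rw [h2] at h1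
    simp only [neg_mul, integral_neg] at h1
    simp only [E, W]
    linarith
  have hz : ∀ f : Ed d → ℝ, IsTest f → ∫ x, f x * (V x * ψ x ^ 2) = 0 := by
    intro f hf
    obtain ⟨R, hR⟩ := hf.2.isCompact.isBounded.subset_closedBall 0
    have gi : ∀ g, IsTest g → Integrable fun x => ψ x ^ 2 * ‖gradient g x‖ ^ 2 := by
      intro g hg
      simp_rw [norm_grad]
      have := hg.1.continuous_fderiv (by simp)
      exact cint _ hg.2.isCompact (by fun_prop) fun x hx => by
        rw [fderiv_of_notMem_tsupport (𝕜 := ℝ) hx]; simp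
    have wi : ∀ g, IsTest g → Integrable fun x => V x * ψ x ^ 2 * g x ^ 2 := by
      intro g hg
      have := hg.1.continuous
      exact cint _ hg.2.isCompact (by fun_prop) fun x hx => by
        rw [image_eq_zero_of_notMem_tsupport hx]; simp
    have fi : Integrable fun x => f x * (V x * ψ x ^ 2) := by
      have := hf.1.continuous
      exact cint _ hf.2.isCompact (by fun_prop) fun x hx => by
        rw [image_eq_zero_of_notMem_tsupport hx]; simp
    set A := ∫ x, f x * (V x * ψ x ^ 2) with hA
    have ineq : ∀ t : ℝ, ∀ ε > 0, 4 * t * A ≤ 2 * ε + 2 * t ^ 2 * E f := by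
      intro t ε hε
      obtain ⟨φ, hφ, hφ1, hφE⟩ := cutoff hd2 ψ hψc hψpos M hM R ε hε
      have tst : ∀ s : ℝ, IsTest (fun y => φ y + s * f y) := fun s =>
        ⟨hφ.1.add (contDiff_const.mul hf.1), hφ.2.add hf.2.mul_left⟩
      have e1 : E (fun y => φ y + t * f y) + E (fun y => φ y + (-t) * f y)
          = 2 * E φ + 2 * t ^ 2 * E f := by
        simp only [E]
        rw [← integral_add (gi _ (tst t)) (gi _ (tst (-t))), ← integral_const_mul,
          ← integral_const_mul, ← integral_add ((gi _ hφ).const_mul _) ((gi _ hf).const_mul _)]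
        refine integral_congr_ae (Filter.Eventually.of_forall fun x => ?_)
        simp only
        rw [grad_lin _ _ (hφ.1.differentiable (by simp)) (hf.1.differentiable (by simp)),
          grad_lin _ _ (hφ.1.differentiable (by simp)) (hf.1.differentiable (by simp)),
          neg_smul, ← sub_eq_add_neg]
        have p := parallelogram_law_with_norm ℝ (gradient φ x) (t • gradient f x)
        have n2 : ‖t • gradient f x‖ ^ 2 = t ^ 2 * ‖gradient f x‖ ^ 2 := by
          rw [norm_smul, mul_pow, Real.norm_eq_abs, sq_abs]
        rw [n2] at p
        linear_combination (ψ x ^ 2) * p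
      have e2 : W (fun y => φ y + t * f y) - W (fun y => φ y + (-t) * f y) = 4 * t * A := by
        simp only [W]
        rw [hA, ← integral_sub (wi _ (tst t)) (wi _ (tst (-t))), ← integral_const_mul]
        refine integral_congr_ae (Filter.Eventually.of_forall fun x => ?_)
        simp only
        by_cases hx : f x = 0
        · rw [hx]; ring
        · have : φ x = 1 := hφ1 x (by
            simpa using hR (subset_tsupport _ hx))
          rw [this]; ring
      have h1 := b2 _ (tst t)
      have h2 := b1 _ (tst (-t))
      have h3 : E φ ≤ ε := hφE
      linarith
    have ineq2 : ∀ t : ℝ, 4 * t * A ≤ 2 * t ^ 2 * E f := by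
      intro t
      refine le_of_forall_pos_le_add fun δ hδ => ?_
      have := ineq t (δ / 2) (by positivity)
      linarith
    have hE : 0 ≤ E f := integral_nonneg fun x => by positivity
    have h := ineq2 (A / (E f + 1))
    have hp : 0 < E f + 1 := by linarith
    have h2 : 4 * A * A * (E f + 1) ≤ 2 * A ^ 2 * E f := by
      have := mul_le_mul_of_nonneg_right h (sq_nonneg (E f + 1))
      have e1 : 4 * (A / (E f + 1)) * A * (E f + 1) ^ 2 = 4 * A * A * (E f + 1) := by
        field_simp
      have e2 : 2 * (A / (E f + 1)) ^ 2 * E f * (E f + 1) ^ 2 = 2 * A ^ 2 * E f := by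
        field_simp
      linarith
    have h3 : A ^ 2 ≤ 0 := by nlinarith [mul_nonneg (sq_nonneg A) hE]
    exact pow_eq_zero_iff (two_ne_zero) |>.1 (le_antisymm h3 (sq_nonneg A))
  have hc : Continuous fun x => V x * ψ x ^ 2 := by fun_prop
  have hae := ae_eq_zero_of_integral_contDiff_smul_eq_zero (μ := (volume : Measure (Ed d)))
    hc.locallyIntegrable (fun g hg hg' => hz g ⟨hg, hg'⟩)
  have hall := (hc.ae_eq_iff_eq (volume : Measure (Ed d)) continuous_const).1 hae
  intro x
  have := congrFun hall x
  simpa [(hψpos x).ne'] using this
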